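/- Let I, k, m, N be positive integers, let J ⊂ ℤ be a set of cardinality I, and for each i ∈ J let Q_i ⊆ ([−4^i m, −(4^i/2) m) ∪ ((4^i/2) m, 4^i m]) ∩ ℤ with |Q_i| = N, the sets Q_i being pairwise disjoint. Let Q = ⋃_{i∈J} Q_i. Then T_k(Q) ≤ 2^{8k} k^k I^k N^{2k−1}. -/

import Mathlib

open scoped BigOperators

/-- `T_k(Q)`: the number of `2k`-tuples `(x₁, …, x_k, x₁', …, x_k') ∈ Q^{2k}` with
`x₁ + ⋯ + x_k = x₁' + ⋯ + x_k'`. -/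
noncomputable def TkZ (k : ℕ) (Q : Finset ℤ) : ℕ :=
  Set.ncard {xy : (Fin k → ℤ) × (Fin k → ℤ) |
    (∀ i, xy.1 i ∈ Q) ∧ (∀ i, xy.2 i ∈ Q) ∧ ∑ i, xy.1 i = ∑ i, xy.2 i}

theorem conv2 {S : Set ℝ} {f : ℝ → ℝ} (h : ConvexOn ℝ S f) (x y a b : ℝ) (hx : x ∈ S) (hy : y ∈ S)
    (ha : 0 ≤ a) (hb : 0 ≤ b) (hab : a + b = 1) : f (a * x + b * y) ≤ a * f x + b * f y :=
  h.2 hx hy ha hb hab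

theorem ps_bound (a b : ℝ) (ha : 0 ≤ a) (hb : 0 ≤ b) (n : ℕ) :
    2 * (n + 1) * a ^ n * b ≤ (a + b) ^ (n + 1) - (a - b) ^ (n + 1) ∧
      2 * a ^ (n + 1) ≤ (a + b) ^ (n + 1) + (a - b) ^ (n + 1) := by
  induction n with
  | zero => constructor <;> simp <;> linarith
  | succ n ih =>
    obtain ⟨h1, h2⟩ := ih
    have e1 : (a + b) ^ (n + 1 + 1) - (a - b) ^ (n + 1 + 1)
      = a * ((a + b) ^ (n + 1) - (a - b) ^ (n + 1)) + b * ((a + b) ^ (n + 1) + (a - b) ^ (n + 1)) := by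
      ring
    have e2 : (a + b) ^ (n + 1 + 1) + (a - b) ^ (n + 1 + 1)
      = a * ((a + b) ^ (n + 1) + (a - b) ^ (n + 1)) + b * ((a + b) ^ (n + 1) - (a - b) ^ (n + 1)) := by
      ring
    have f1 := mul_le_mul_of_nonneg_left h1 ha
    have f2 := mul_le_mul_of_nonneg_left h2 hb
    have f3 := mul_le_mul_of_nonneg_left h1 hb
    have f4 := mul_le_mul_of_nonneg_left h2 ha
    have f5 : 0 ≤ b * (2 * (n + 1) * a ^ n * b) := by positivity
    constructor
    · rw [e1]; push_cast
      calc _ = a * (2 * (n + 1) * a ^ n * b) + b * (2 * a ^ (n+1)) := by ring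
        _ ≤ _ := by linarith
    · rw [e2]
      calc _ = a * (2 * a ^ (n + 1)) := by ring
        _ ≤ _ := by linarith

/-- pointwise expansion inequality -/
theorem pointwise_real (k : ℕ) (hk : 0 < k) (a b r : ℝ) (ha : 0 ≤ a) (hb : 0 ≤ b)
    (hr : |r| ≤ a * b) :
    (a ^ 2 + b ^ 2 + 2 * r) ^ k ≤
      (a + b) ^ (2 * k) - 2 * k * a ^ (2 * k - 1) * b + 2 * k * (a ^ (2 * k - 2) * r) := by
  obtain ⟨hr1, hr2⟩ := abs_le.mp hr
  obtain ⟨n, rfl⟩ : ∃ n, k = n + 1 := ⟨k - 1, by omega⟩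
  have hab : 0 ≤ a * b := by positivity
  rcases hab.eq_or_lt with h0 | hpos
  · have hr0 : r = 0 := by linarith
    have : (a + b) ^ (2 * (n + 1)) = (a ^ 2 + b ^ 2) ^ (n + 1) := by
      rw [pow_mul]; congr 1; nlinarith
    have h3 : a ^ (2 * (n + 1) - 1) * b = 0 := by
      have : 2 * (n + 1) - 1 = 2 * n + 1 := by omega
      rw [this, pow_succ, mul_assoc, ← h0, mul_zero]
    rw [mul_assoc (2 * ((n + 1 : ℕ) : ℝ)), h3, hr0, this]; simp
  · set t : ℝ := (a * b - r) / (2 * (a * b)) with ht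
    have ht0 : 0 ≤ t := div_nonneg (by linarith) (by linarith)
    have ht1 : t ≤ 1 := by rw [ht, div_le_one (by linarith)]; linarith
    have htt : r = a * b - 2 * t * (a * b) := by 
      have h7 : t * (2 * (a * b)) = a * b - r := div_mul_cancel₀ _ (by positivity)
      linarith
    have hconv := conv2 (convexOn_pow (𝕜 := ℝ) (n + 1)) ((a + b) ^ 2) ((a - b) ^ 2) (1 - t) t
      (by simp [sq_nonneg]) (by simp [sq_nonneg]) (by linarith) ht0 (by ring)
    simp only [← pow_mul] at hconv
    have e : (1 - t) * (a + b) ^ 2 + t * (a - b) ^ 2 = a ^ 2 + b ^ 2 + 2 * r := by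
      rw [htt]; ring
    rw [e] at hconv
    have hp := (ps_bound a b ha hb (2 * n + 1)).1
    have i1 : 2 * (n + 1) - 1 = 2 * n + 1 := by omega
    have i2 : 2 * (n + 1) - 2 = 2 * n := by omega
    have i3 : 2 * n + 1 + 1 = 2 * (n + 1) := by omega
    rw [i1, i2]
    rw [i3] at hp
    have := mul_le_mul_of_nonneg_left hp ht0
    have e3 : 2 * ((n + 1 : ℕ) : ℝ) * (a ^ (2 * n) * r)
       = 2 * ((n + 1 : ℕ) : ℝ) * a ^ (2 * n + 1) * b
         - t * (2 * (((2 * n + 1 : ℕ) : ℝ) + 1) * a ^ (2 * n + 1) * b) := by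
      rw [htt]; push_cast; ring
    rw [e3]; linarith

theorem even_moment (k : ℕ) (hk : 0 < k) (x : ℝ) (hx : 0 ≤ x) :
    (1 + x) ^ (2 * k) + (1 - x) ^ (2 * k) ≤ 2 * (1 + 7 * (k * x ^ 2)) ^ k := by
  have hk1 : (1 : ℝ) ≤ k := by exact_mod_cast hk
  set y : ℝ := k * x ^ 2 with hy
  have hxy : x ^ 2 ≤ y := by rw [hy]; nlinarith [sq_nonneg x]
  by_cases h : y ≤ 1
  · have hx1 : x ≤ 1 := by nlinarith
    have h1 : (1 + x) ^ (2 * k) ≤ Real.exp (2 * k * x) := by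
      calc (1 + x) ^ (2 * k) ≤ (Real.exp x) ^ (2 * k) := by
            gcongr; linarith [Real.add_one_le_exp x]
        _ = _ := by rw [← Real.exp_nat_mul]; push_cast; rfl
    have h2 : (1 - x) ^ (2 * k) ≤ Real.exp (-(2 * k * x)) := by
      calc (1 - x) ^ (2 * k) ≤ (Real.exp (-x)) ^ (2 * k) := by
            apply pow_le_pow_left₀ (by linarith); linarith [Real.add_one_le_exp (-x)]
        _ = _ := by rw [← Real.exp_nat_mul]; push_cast; ring_nf
    have h3 := Real.cosh_le_exp_half_sq (2 * k * x)
    rw [Real.cosh_eq] at h3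
    have h4 : Real.exp ((2 * k * x) ^ 2 / 2) = (Real.exp (2 * y)) ^ k := by
      rw [← Real.exp_nat_mul, hy]; ring_nf
    have hy0 : 0 ≤ y := by positivity
    have h5 : Real.exp (2 * y) ≤ 1 + 7 * y := by
      have hc := conv2 convexOn_exp 0 2 (1 - y) y (by simp) (by simp) (by linarith) hy0 (by ring)
      simp only [mul_zero, zero_add, Real.exp_zero] at hc
      have he : Real.exp 2 ≤ 8 := by
        have h1 := Real.exp_one_lt_d9
        have : Real.exp 2 = Real.exp 1 * Real.exp 1 := by rw [← Real.exp_add]; norm_num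
        rw [this]; nlinarith [Real.exp_pos 1]
      rw [mul_comm 2 y]
      nlinarith
    have h6 : (Real.exp (2 * y)) ^ k ≤ (1 + 7 * y) ^ k := by gcongr
    rw [h4] at h3
    linarith
  · push Not at h
    have h1 : (1 + x) ^ (2 * k) ≤ (1 + 7 * y) ^ k := by
      rw [pow_mul]; gcongr; nlinarith [sq_nonneg (1 - x)]
    have h2 : (1 - x) ^ (2 * k) ≤ (1 + 7 * y) ^ k := by
      rw [pow_mul]; gcongr; nlinarith
    linarith

theorem numeric1 (k : ℕ) (hk : 0 < k) (x : ℝ) (hx : 0 ≤ x) :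
    (1 + x) ^ (2 * k) - 2 * k * x + 8 * k ^ 2 * x ^ 2 ≤ (1 + 22 * (k * x ^ 2)) ^ k := by
  have h1 := even_moment k hk x hx
  set y : ℝ := k * x ^ 2 with hy
  have hy0 : 0 ≤ y := by positivity
  have h2 : 1 - 2 * k * x ≤ (1 - x) ^ (2 * k) := by
    have := one_add_mul_le_pow (a := x ^ 2 - 2 * x) (by nlinarith [sq_nonneg (x - 1)]) k
    have e : (1 - x) ^ (2 * k) = (1 + (x ^ 2 - 2 * x)) ^ k := by rw [pow_mul]; ring_nf
    rw [e]
    have : 0 ≤ (k : ℝ) * x ^ 2 := by positivity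
    nlinarith
  have h3 : 2 * (1 + 7 * y) ^ k ≤ 1 + (1 + 14 * y) ^ k := by
    have hconv := conv2 (convexOn_pow (𝕜 := ℝ) k) 1 (1 + 14 * y) (1 / 2) (1 / 2)
      (by simp) (by simp; positivity) (by norm_num) (by norm_num) (by norm_num)
    have e : 1 / 2 * 1 + 1 / 2 * (1 + 14 * y) = 1 + 7 * y := by ring
    rw [e, one_pow] at hconv
    linarith
  have h4 : (1 + 14 * y) ^ k + k * (8 * y) ≤ (1 + 22 * y) ^ k := by
    have key : ∀ n : ℕ, (1 + 14 * y) ^ n + n * (8 * y) ≤ (1 + 22 * y) ^ n := by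
      intro n
      induction n with
      | zero => simp
      | succ n ih =>
        have hp : 1 ≤ (1 + 14 * y) ^ n := one_le_pow₀ (by linarith)
        have := mul_le_mul_of_nonneg_right ih (show 0 ≤ 1 + 22 * y by linarith)
        rw [pow_succ, pow_succ]
        push_cast
        have q1 : 0 ≤ (n : ℝ) * y * y := by positivity
        nlinarith
    exact key k
  have h5 : 8 * (k:ℝ) ^ 2 * x ^ 2 = k * (8 * y) := by rw [hy]; ring
  rw [h5]; linarith

theorem numeric2 (k : ℕ) (hk : 0 < k) (A B : ℝ) (hA : 0 < A) (hB : 0 ≤ B) :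
    (A + B) ^ (2 * k) - 2 * k * A ^ (2 * k - 1) * B + 8 * k ^ 2 * A ^ (2 * k - 2) * B ^ 2
      ≤ (A ^ 2 + 22 * k * B ^ 2) ^ k := by
  have h := mul_le_mul_of_nonneg_left (numeric1 k hk (B / A) (by positivity))
    (show 0 ≤ A ^ (2 * k) by positivity)
  obtain ⟨n, rfl⟩ : ∃ n, k = n + 1 := ⟨k - 1, by omega⟩
  have i1 : 2 * (n + 1) - 1 = 2 * n + 1 := by omega
  have i2 : 2 * (n + 1) - 2 = 2 * n := by omega
  rw [i1, i2]
  have e1 : (A + B) ^ (2 * (n + 1)) = A ^ (2 * (n + 1)) * (1 + B / A) ^ (2 * (n + 1)) := by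
    rw [← mul_pow]; congr 1; field_simp
  have e2 : (A ^ 2 + 22 * ((n + 1 : ℕ) : ℝ) * B ^ 2) ^ (n + 1)
      = A ^ (2 * (n + 1)) * (1 + 22 * (((n + 1 : ℕ) : ℝ) * (B / A) ^ 2)) ^ (n + 1) := by
    rw [pow_mul, ← mul_pow]; congr 1; field_simp
  rw [e1, e2]
  refine le_trans (le_of_eq ?_) h
  have e3 : A ^ (2 * (n + 1)) = A ^ (2 * n) * A ^ 2 := by ring
  have e4 : A ^ (2 * n + 1) = A ^ (2 * n) * A := by ring
  rw [e4, mul_add (A ^ (2 * (n + 1))), mul_sub]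
  congr 1
  · congr 1; rw [e3]; field_simp
  · rw [e3]; field_simp

theorem young (n j : ℕ) (hj : j ≤ n) (hn : 0 < n) (a b A B : ℝ) (ha : 0 ≤ a) (hb : 0 ≤ b)
    (hA : 0 < A) (hB : 0 < B) :
    a ^ (n - j) * b ^ j ≤ A ^ (n - j) * B ^ j *
      (((n - j : ℕ) : ℝ) / n * (a ^ n / A ^ n) + (j : ℝ) / n * (b ^ n / B ^ n)) := by
  have hn' : (0 : ℝ) < n := by exact_mod_cast hn
  have h := Real.geom_mean_le_arith_mean2_weighted (w₁ := ((n - j : ℕ) : ℝ) / n) (w₂ := (j : ℝ) / n)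
    (p₁ := (a / A) ^ n) (p₂ := (b / B) ^ n) (by positivity) (by positivity) (by positivity)
    (by positivity) (by rw [← add_div, ← Nat.cast_add, Nat.sub_add_cancel hj]; field_simp)
  have e : ∀ (u : ℝ) (i : ℕ), 0 ≤ u → (u ^ n) ^ ((i : ℝ) / n) = u ^ i := by
    intro u i hu
    rw [← Real.rpow_natCast, ← Real.rpow_mul hu, mul_div_cancel₀ _ hn'.ne', Real.rpow_natCast]
  rw [e _ _ (by positivity), e _ _ (by positivity)] at h
  simp only [div_pow] at h
  have := mul_le_mul_of_nonneg_left h (show 0 ≤ A ^ (n - j) * B ^ j by positivity)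
  refine le_trans (le_of_eq ?_) this
  field_simp

open MeasureTheory

/-- normalised Haar measure on the circle -/
noncomputable abbrev mu1 : Measure (AddCircle (1 : ℝ)) := AddCircle.haarAddCircle

/-- exponential sum -/
noncomputable def expS (P : Finset ℤ) (x : AddCircle (1 : ℝ)) : ℂ := ∑ q ∈ P, fourier q x

theorem expS_cont (P : Finset ℤ) : Continuous (expS P) := by
  unfold expS
  exact continuous_finsetSum _ (fun q _ => (fourier q).continuous)

theorem integ {E : Type*} [NormedAddCommGroup E] {f : AddCircle (1 : ℝ) → E} (hf : Continuous f) :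
    Integrable f mu1 :=
  hf.integrable_of_hasCompactSupport (HasCompactSupport.of_compactSpace f)

theorem int_fourier (n : ℤ) : ∫ x, (fourier n x : ℂ) ∂mu1 = if n = 0 then 1 else 0 := by
  split_ifs with h
  · simp [h]
  · exact integral_eq_zero_of_add_right_eq_neg (μ := mu1)
      (fourier_add_half_inv_index h one_pos)

theorem fourier_sum {ι : Type*} (s : Finset ι) (n : ι → ℤ) (x : AddCircle (1 : ℝ)) :
    (fourier (∑ a ∈ s, n a) x : ℂ) = ∏ a ∈ s, fourier (n a) x := by
  classical
  induction s using Finset.induction_on with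
  | empty => simp
  | insert a s ha ih => rw [Finset.sum_insert ha, Finset.prod_insert ha, fourier_add, ih]

theorem int_prod {ι : Type*} [Fintype ι] [DecidableEq ι] (P : ι → Finset ℤ) (c : ι → ℤ → ℝ)
    (ε : ι → ℤ) :
    ∫ x, ∏ a, ∑ q ∈ P a, (c a q : ℂ) * fourier (ε a * q) x ∂mu1 =
      ((∑ p ∈ Fintype.piFinset P, if ∑ a, ε a * p a = 0 then ∏ a, c a (p a) else 0 : ℝ) : ℂ) := by
  simp_rw [Finset.prod_univ_sum, Finset.prod_mul_distrib, ← fourier_sum]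
  rw [integral_finsetSum]
  · push_cast
    refine Finset.sum_congr rfl fun p _ => ?_
    rw [integral_const_mul, int_fourier]
    split_ifs <;> simp
  · intro p _
    exact integ (continuous_const.mul (fourier _).continuous)

theorem signed_sum (P : Finset ℤ) (c : ℤ → ℝ) (x : AddCircle (1 : ℝ)) :
    ∑ q ∈ P, (c q : ℂ) * fourier (-1 * q) x
      = (starRingEnd ℂ) (∑ q ∈ P, (c q : ℂ) * fourier q x) := by
  rw [map_sum]
  refine Finset.sum_congr rfl fun q _ => ?_
  rw [neg_one_mul, fourier_neg, map_mul, Complex.conj_ofReal]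

theorem signed_norm (P : Finset ℤ) (c : ℤ → ℝ) (e : ℤ) (he : e = 1 ∨ e = -1)
    (x : AddCircle (1 : ℝ)) :
    ‖∑ q ∈ P, (c q : ℂ) * fourier (e * q) x‖ = ‖∑ q ∈ P, (c q : ℂ) * fourier q x‖ := by
  rcases he with rfl | rfl
  · simp
  · rw [signed_sum, RCLike.norm_conj]

theorem expS_eq (P : Finset ℤ) (x : AddCircle (1 : ℝ)) :
    expS P x = ∑ q ∈ P, ((1 : ℝ) : ℂ) * fourier q x := by simp [expS]

theorem Tk_eq (k : ℕ) (Q : Finset ℤ) : (TkZ k Q : ℝ) = ∫ x, ‖expS Q x‖ ^ (2 * k) ∂mu1 := by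
  have h := int_prod (ι := Fin k ⊕ Fin k) (fun _ => Q) (fun _ _ => 1) (Sum.elim (fun _ => 1) (fun _ => -1))
  simp only [Fintype.prod_sum_type, Sum.elim_inl, Sum.elim_inr, signed_sum, one_mul, ← expS_eq,
    Finset.prod_const, Finset.card_univ, Fintype.card_fin, ← mul_pow, Complex.mul_conj,
    Complex.normSq_eq_norm_sq, one_pow, mul_one, Fintype.sum_sum_type] at h
  have h2 : ∫ x, (((‖expS Q x‖ ^ 2 : ℝ) : ℂ)) ^ k ∂mu1 = ((∫ x, ‖expS Q x‖ ^ (2 * k) ∂mu1 : ℝ) : ℂ) := by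
    rw [← integral_complex_ofReal]
    congr 1; ext x; push_cast; rw [pow_mul]
  rw [h2] at h
  rw [Complex.ofReal_inj.mp h, ← Finset.sum_filter, Finset.sum_const, nsmul_eq_mul, mul_one]
  congr 1
  unfold TkZ
  rw [← Set.ncard_coe_finset]
  refine Set.ncard_congr (fun xy _ => Sum.elim xy.1 xy.2) ?_ ?_ ?_
  · rintro ⟨x, y⟩ ⟨h1, h2, h3⟩
    simp only [Finset.coe_filter, Set.mem_setOf_eq, Fintype.mem_piFinset]
    refine ⟨?_, ?_⟩
    · rintro (i | i)
      · exact h1 i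
      · exact h2 i
    · simp at h3 ⊢
      rw [h3]; ring
  · rintro ⟨x, y⟩ ⟨x', y'⟩ _ _ h
    ext i
    · exact congrFun h (Sum.inl i)
    · exact congrFun h (Sum.inr i)
  · intro p hp
    simp only [Finset.coe_filter, Set.mem_setOf_eq, Fintype.mem_piFinset] at hp
    refine ⟨(fun i => p (Sum.inl i), fun i => p (Sum.inr i)), ⟨fun i => hp.1 _, fun i => hp.1 _, ?_⟩, ?_⟩
    · have := hp.2
      simp only [neg_one_mul, Finset.sum_neg_distrib] at this
      exact add_neg_eq_zero.mp this
    · ext (i | i) <;> rfl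

theorem lin_count {ι : Type*} [Fintype ι] [DecidableEq ι] (o : ι) (ε : ι → ℤ)
    (hε : ∀ a, ε a = 1 ∨ ε a = -1) (P G : Finset ℤ) (W : ℤ → ℝ) (V : ℝ)
    (hG : ∀ z ∈ G, V ≤ |(z : ℝ)|) (hW : ∀ q ∈ P, |(q : ℝ)| ≤ W q) :
    V * (∑ p ∈ Fintype.piFinset (fun a => if a = o then G else P),
        if ∑ a, ε a * p a = 0 then (1 : ℝ) else 0) ≤
      ∑ a ∈ Finset.univ.erase o, ∫ x, ‖expS G x‖ * ‖∑ q ∈ P, (W q : ℂ) * fourier q x‖ *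
        ‖expS P x‖ ^ (Fintype.card ι - 2) ∂mu1 := by
  have step1 : V * (∑ p ∈ Fintype.piFinset (fun a => if a = o then G else P),
        if ∑ a, ε a * p a = 0 then (1 : ℝ) else 0) ≤
      ∑ p ∈ Fintype.piFinset (fun a => if a = o then G else P),
        ∑ a ∈ Finset.univ.erase o, if ∑ b, ε b * p b = 0 then W (p a) else 0 := by
    rw [Finset.mul_sum]
    refine Finset.sum_le_sum fun p hp => ?_
    rw [Fintype.mem_piFinset] at hp
    split_ifs with h0
    · rw [mul_one]
      have ho := hp o
      simp only [if_true] at ho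
      refine (hG _ ho).trans ?_
      have habs : ∀ a, |((ε a * p a : ℤ) : ℝ)| = |(p a : ℝ)| := by
        intro a
        rcases hε a with h | h <;> simp [h]
      have e1 : ((ε o * p o : ℤ) : ℝ) = - ∑ a ∈ Finset.univ.erase o, ((ε a * p a : ℤ) : ℝ) := by
        have := Finset.add_sum_erase Finset.univ (fun a => ε a * p a) (Finset.mem_univ o)
        rw [h0] at this
        have h' : ε o * p o = - ∑ a ∈ Finset.univ.erase o, ε a * p a := by linarith
        rw [h']; push_cast; rfl
      rw [← habs o, e1, abs_neg]
      refine (Finset.abs_sum_le_sum_abs _ _).trans (Finset.sum_le_sum fun a ha => ?_)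
      rw [habs]
      have hpa := hp a
      rw [if_neg (Finset.ne_of_mem_erase ha)] at hpa
      exact hW _ hpa
    · simp
  refine step1.trans ?_
  rw [Finset.sum_comm]
  refine Finset.sum_le_sum fun a ha => ?_
  have hao := Finset.ne_of_mem_erase ha
  have h := int_prod (fun a => if a = o then G else P) (fun b q => if b = a then W q else 1) ε
  have e2 : ∀ p : ι → ℤ, ∏ b, (if b = a then W (p b) else 1) = W (p a) := by
    intro p; simp
  simp only [e2] at h
  have h3 := congrArg norm h
  rw [Complex.norm_real, Real.norm_eq_abs] at h3
  refine (le_abs_self _).trans ?_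
  rw [← h3]
  refine (norm_integral_le_integral_norm _).trans (le_of_eq ?_)
  congr 1; ext x
  rw [norm_prod, ← Finset.mul_prod_erase _ _ (Finset.mem_univ o), ← Finset.mul_prod_erase _ _ ha,
    ← mul_assoc]
  simp only [signed_norm _ _ _ (hε _)]
  congr 1
  · congr 1
    · simp [Ne.symm hao, expS]
    · simp [hao]
  · rw [Finset.prod_congr rfl (g := fun _ => ‖expS P x‖)]
    · rw [Finset.prod_const, Finset.card_erase_of_mem ha, Finset.card_erase_of_mem (Finset.mem_univ _),
        Finset.card_univ]
      rfl
    · intro b hb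
      have hb1 := Finset.ne_of_mem_erase hb
      have hb2 := Finset.ne_of_mem_erase (Finset.mem_of_mem_erase hb)
      simp [hb1, hb2, expS]

theorem lin_eq (k : ℕ) (hk : 0 < k) (P G : Finset ℤ) :
    ∫ x, ‖expS P x‖ ^ (2 * k - 2) * ((starRingEnd ℂ) (expS P x) * expS G x).re ∂mu1 =
      ∑ p ∈ Fintype.piFinset (fun a : Fin k ⊕ Fin k => if a = Sum.inl ⟨0, hk⟩ then G else P),
        if ∑ a, (Sum.elim (fun _ => 1) (fun _ => -1) a : ℤ) * p a = 0 then (1 : ℝ) else 0 := by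
  have h := int_prod (fun a : Fin k ⊕ Fin k => if a = Sum.inl ⟨0, hk⟩ then G else P)
    (fun _ _ => 1) (Sum.elim (fun _ => 1) (fun _ => -1))
  simp only [Finset.prod_const_one] at h
  have h3 := congrArg Complex.re h
  rw [Complex.ofReal_re] at h3
  rw [← h3]
  have hpt : ∀ x : AddCircle (1 : ℝ), (∏ a : Fin k ⊕ Fin k,
      ∑ q ∈ (if a = Sum.inl ⟨0, hk⟩ then G else P),
        ((1 : ℝ) : ℂ) * fourier ((Sum.elim (fun _ => 1) (fun _ => -1) a : ℤ) * q) x)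
      = ((‖expS P x‖ ^ (2 * k - 2) : ℝ) : ℂ) * ((starRingEnd ℂ) (expS P x) * expS G x) := by
    intro x
    rw [Fintype.prod_sum_type]
    have r : (∏ a : Fin k, ∑ q ∈ (if (Sum.inr a : Fin k ⊕ Fin k) = Sum.inl ⟨0, hk⟩ then G else P),
        ((1 : ℝ) : ℂ) * fourier ((Sum.elim (fun _ => 1) (fun _ => -1) (Sum.inr a : Fin k ⊕ Fin k) : ℤ) * q) x)
        = (starRingEnd ℂ) (expS P x) ^ k := by
      simp only [reduceCtorEq, if_false, Sum.elim_inr, signed_sum, ← expS_eq]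
      simp
    have l : (∏ a : Fin k, ∑ q ∈ (if (Sum.inl a : Fin k ⊕ Fin k) = Sum.inl ⟨0, hk⟩ then G else P),
        ((1 : ℝ) : ℂ) * fourier ((Sum.elim (fun _ => 1) (fun _ => -1) (Sum.inl a : Fin k ⊕ Fin k) : ℤ) * q) x)
        = expS G x * expS P x ^ (k - 1) := by
      rw [← Finset.mul_prod_erase _ _ (Finset.mem_univ (⟨0, hk⟩ : Fin k))]
      congr 1
      · simp [expS]
      · rw [Finset.prod_congr rfl (g := fun _ => expS P x)]
        · rw [Finset.prod_const, Finset.card_erase_of_mem (Finset.mem_univ _)]; simp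
        · intro b hb
          have := Finset.ne_of_mem_erase hb
          simp [this, expS]
    rw [r, l]
    obtain ⟨n, rfl⟩ : ∃ n, k = n + 1 := ⟨k - 1, by omega⟩
    have i2 : 2 * (n + 1) - 2 = 2 * n := by omega
    rw [i2, Nat.add_sub_cancel, pow_mul, ← Complex.normSq_eq_norm_sq, Complex.ofReal_pow,
      ← Complex.mul_conj, mul_pow]
    ring
  simp_rw [hpt]
  have hc : Continuous fun x => ((‖expS P x‖ ^ (2 * k - 2) : ℝ) : ℂ) * ((starRingEnd ℂ) (expS P x) * expS G x) := by
    have h1 := expS_cont P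
    have h2 := expS_cont G
    exact (Complex.continuous_ofReal.comp (h1.norm.pow _)).mul ((Complex.continuous_conj.comp h1).mul h2)
  have := integral_re (𝕜 := ℂ) (integ hc)
  simp only [RCLike.re_to_complex] at this
  rw [← this]
  congr 1; ext x
  rw [Complex.re_ofReal_mul]

theorem hold (n j : ℕ) (hj : j ≤ n) (hn : 0 < n) (a b : AddCircle (1 : ℝ) → ℝ)
    (ha : Continuous a) (hb : Continuous b) (ha0 : ∀ x, 0 ≤ a x) (hb0 : ∀ x, 0 ≤ b x)
    (A B : ℝ) (hA : 0 < A) (hB : 0 < B) (hIa : ∫ x, a x ^ n ∂mu1 ≤ A ^ n)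
    (hIb : ∫ x, b x ^ n ∂mu1 ≤ B ^ n) :
    ∫ x, a x ^ (n - j) * b x ^ j ∂mu1 ≤ A ^ (n - j) * B ^ j := by
  have hn' : (0 : ℝ) < n := by exact_mod_cast hn
  have hia : Integrable (fun x => a x ^ n / A ^ n) mu1 := integ ((ha.pow n).div_const _)
  have hib : Integrable (fun x => b x ^ n / B ^ n) mu1 := integ ((hb.pow n).div_const _)
  calc ∫ x, a x ^ (n - j) * b x ^ j ∂mu1
      ≤ ∫ x, A ^ (n - j) * B ^ j * (((n - j : ℕ) : ℝ) / n * (a x ^ n / A ^ n)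
          + (j : ℝ) / n * (b x ^ n / B ^ n)) ∂mu1 := by
        refine integral_mono (integ ((ha.pow _).mul (hb.pow _)))
          (((hia.const_mul _).add (hib.const_mul _)).const_mul _) fun x => ?_
        exact young n j hj hn _ _ _ _ (ha0 x) (hb0 x) hA hB
    _ = A ^ (n - j) * B ^ j * (((n - j : ℕ) : ℝ) / n * ((∫ x, a x ^ n ∂mu1) / A ^ n)
          + (j : ℝ) / n * ((∫ x, b x ^ n ∂mu1) / B ^ n)) := by
        rw [integral_const_mul, integral_add (hia.const_mul _) (hib.const_mul _),
          integral_const_mul, integral_const_mul, integral_div, integral_div]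
    _ ≤ A ^ (n - j) * B ^ j * (((n - j : ℕ) : ℝ) / n * 1 + (j : ℝ) / n * 1) := by
        gcongr
        · exact (div_le_one (by positivity)).mpr hIa
        · exact (div_le_one (by positivity)).mpr hIb
    _ = _ := by
        rw [mul_one, mul_one, ← add_div, ← Nat.cast_add, Nat.sub_add_cancel hj, div_self hn'.ne',
          mul_one]

theorem binom_split (k : ℕ) (hk : 0 < k) (a b : ℝ) :
    (a + b) ^ (2 * k) - 2 * k * a ^ (2 * k - 1) * b =
      ∑ j ∈ (Finset.range (2 * k + 1)).erase 1, ((2 * k).choose j : ℝ) * (a ^ (2 * k - j) * b ^ j) := by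
  rw [add_comm a b, add_pow, ← Finset.add_sum_erase _ _ (show 1 ∈ Finset.range (2 * k + 1) by
    simp; omega)]
  simp only [pow_one, Nat.choose_one_right]
  push_cast
  rw [show ∀ u v w : ℝ, u + v - w = v + (u - w) from fun u v w => by ring]
  rw [show b * a ^ (2 * k - 1) * (2 * (k : ℝ)) - 2 * k * a ^ (2 * k - 1) * b = 0 by ring, add_zero]
  exact Finset.sum_congr rfl fun j _ => by ring

theorem main_int (k : ℕ) (hk : 0 < k) (a b : AddCircle (1 : ℝ) → ℝ)
    (ha : Continuous a) (hb : Continuous b) (ha0 : ∀ x, 0 ≤ a x) (hb0 : ∀ x, 0 ≤ b x)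
    (A B : ℝ) (hA : 0 < A) (hB : 0 < B) (hIa : ∫ x, a x ^ (2 * k) ∂mu1 ≤ A ^ (2 * k))
    (hIb : ∫ x, b x ^ (2 * k) ∂mu1 ≤ B ^ (2 * k)) :
    ∫ x, ((a x + b x) ^ (2 * k) - 2 * k * a x ^ (2 * k - 1) * b x) ∂mu1 ≤
      (A + B) ^ (2 * k) - 2 * k * A ^ (2 * k - 1) * B := by
  simp_rw [binom_split k hk]
  rw [integral_finsetSum _ (by
    intro j _
    apply integ; fun_prop)]
  refine Finset.sum_le_sum fun j hj => ?_
  have hj' : j ≤ 2 * k := by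
    have := Finset.mem_range.mp (Finset.mem_of_mem_erase hj); omega
  rw [integral_const_mul]
  gcongr
  exact hold (2 * k) j hj' (by omega) a b ha hb ha0 hb0 A B hA hB hIa hIb

theorem step_int (k : ℕ) (hk : 0 < k) (P G : Finset ℤ) (hd : Disjoint P G)
    (A B : ℝ) (hA : 0 < A) (hB : 0 < B) (hIa : ∫ x, ‖expS P x‖ ^ (2 * k) ∂mu1 ≤ A ^ (2 * k))
    (hIb : ∫ x, ‖expS G x‖ ^ (2 * k) ∂mu1 ≤ B ^ (2 * k)) :
    ∫ x, ‖expS (P ∪ G) x‖ ^ (2 * k) ∂mu1 ≤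
      (A + B) ^ (2 * k) - 2 * k * A ^ (2 * k - 1) * B + 2 * k *
      ∫ x, ‖expS P x‖ ^ (2 * k - 2) * ((starRingEnd ℂ) (expS P x) * expS G x).re ∂mu1 := by
  have hP := expS_cont P
  have hG := expS_cont G
  have hm := main_int k hk (fun x => ‖expS P x‖) (fun x => ‖expS G x‖) hP.norm hG.norm
    (fun _ => norm_nonneg _) (fun _ => norm_nonneg _) A B hA hB hIa hIb
  have hc1 : Integrable (fun x => (‖expS P x‖ + ‖expS G x‖) ^ (2 * k)
      - 2 * k * ‖expS P x‖ ^ (2 * k - 1) * ‖expS G x‖) mu1 := by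
    apply integ; fun_prop
  have hc2 : Integrable (fun x => ‖expS P x‖ ^ (2 * k - 2) *
      ((starRingEnd ℂ) (expS P x) * expS G x).re) mu1 := by
    apply integ
    exact (hP.norm.pow _).mul
      (Complex.continuous_re.comp ((Complex.continuous_conj.comp hP).mul hG))
  calc ∫ x, ‖expS (P ∪ G) x‖ ^ (2 * k) ∂mu1
      ≤ ∫ x, (((‖expS P x‖ + ‖expS G x‖) ^ (2 * k) - 2 * k * ‖expS P x‖ ^ (2 * k - 1) * ‖expS G x‖)
        + 2 * k * (‖expS P x‖ ^ (2 * k - 2) * ((starRingEnd ℂ) (expS P x) * expS G x).re)) ∂mu1 := by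
        refine integral_mono (integ ((expS_cont _).norm.pow _)) (hc1.add (hc2.const_mul _)) fun x => ?_
        have e : expS (P ∪ G) x = expS P x + expS G x := Finset.sum_union hd
        have e2 : ‖expS (P ∪ G) x‖ ^ (2 * k) = (‖expS P x‖ ^ 2 + ‖expS G x‖ ^ 2
            + 2 * ((starRingEnd ℂ) (expS P x) * expS G x).re) ^ k := by
          rw [pow_mul, e]
          congr 1
          simp only [← Complex.normSq_eq_norm_sq, Complex.normSq_apply, Complex.add_re, Complex.add_im,
            Complex.mul_re, Complex.conj_re, Complex.conj_im]
          ring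
        change ‖expS (P ∪ G) x‖ ^ (2 * k) ≤ _
        rw [e2]
        refine pointwise_real k hk _ _ _ (norm_nonneg _) (norm_nonneg _) ?_
        refine (Complex.abs_re_le_norm _).trans (le_of_eq ?_)
        rw [norm_mul, RCLike.norm_conj]
    _ ≤ _ := by
        rw [integral_add hc1 (hc2.const_mul _), integral_const_mul]
        gcongr

theorem level_bound (k N : ℕ) (hk : 0 < k) (G : Finset ℤ) (hG : G.card = N) :
    ∫ x, ‖expS G x‖ ^ (2 * k) ∂mu1 ≤ (N : ℝ) ^ (2 * k - 1) := by
  have h1 : ∫ x, ‖expS G x‖ ^ (2 * 1) ∂mu1 = N := by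
    rw [← Tk_eq, ← hG]
    congr 1
    unfold TkZ
    rw [← Set.ncard_coe_finset]
    refine Set.ncard_congr (fun xy _ => xy.1 0) ?_ ?_ ?_
    · rintro ⟨x, y⟩ ⟨h1, h2, h3⟩; exact h1 0
    · rintro ⟨x, y⟩ ⟨x', y'⟩ ⟨h1, h2, h3⟩ ⟨h1', h2', h3'⟩ h
      simp at h3 h3' h
      ext i
      · simpa [Subsingleton.elim i 0] using h
      · simp [Subsingleton.elim i 0]; rw [← h3, ← h3', h]
    · intro b hb
      exact ⟨(fun _ => b, fun _ => b), ⟨fun _ => hb, fun _ => hb, rfl⟩, rfl⟩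
  have hn : ∀ x, ‖expS G x‖ ≤ N := by
    intro x
    refine (norm_sum_le _ _).trans ?_
    rw [← hG, ← nsmul_one]
    refine Finset.sum_le_card_nsmul _ _ _ fun q _ => ?_
    exact (ContinuousMap.norm_coe_le_norm _ _).trans (fourier_norm (T := 1) q).le
  have hc := expS_cont G
  calc ∫ x, ‖expS G x‖ ^ (2 * k) ∂mu1 ≤ ∫ x, (N : ℝ) ^ (2 * k - 2) * ‖expS G x‖ ^ (2 * 1) ∂mu1 := by
        refine integral_mono (integ (hc.norm.pow _)) (integ (continuous_const.mul (hc.norm.pow _)))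
          fun x => ?_
        change ‖expS G x‖ ^ (2 * k) ≤ _
        rw [show 2 * k = (2 * k - 2) + 2 * 1 by omega, pow_add]
        simp only [Nat.add_sub_cancel, show 2 * k - 2 + 2 * 1 - 2 = 2 * k - 2 by omega]
        gcongr
        exact hn x
    _ = _ := by
        rw [integral_const_mul, h1, ← pow_succ]; congr 1; omega

theorem sum_four (s : Finset ℤ) : ∀ j : ℤ, (∀ i ∈ s, i < j) → ∑ i ∈ s, (4 : ℝ) ^ i ≤ 4 ^ j := by
  induction s using Finset.induction_on_max with
  | empty => intro j _; simp; positivity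
  | insert a s ha ih =>
    intro j hj
    rw [Finset.sum_insert (fun h => lt_irrefl _ (ha a h))]
    have h1 := ih a ha
    have h2 : (4 : ℝ) ^ (a + 1) ≤ 4 ^ j :=
      zpow_le_zpow_right₀ (by norm_num) (hj a (Finset.mem_insert_self _ _))
    rw [zpow_add_one₀ (by norm_num)] at h2
    have : (0 : ℝ) < 4 ^ a := by positivity
    linarith

/-- bound on the linear term -/
theorem lin_bound (k m : ℕ) (hk : 0 < k) (hm : 0 < m) (s : Finset ℤ) (j : ℤ) (hsj : ∀ i ∈ s, i < j)
    (Qf : ℤ → Finset ℤ)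
    (hup : ∀ i ∈ s, ∀ q ∈ Qf i, |(q : ℝ)| ≤ 4 ^ i * m)
    (hlow : ∀ q ∈ Qf j, (4 : ℝ) ^ j / 2 * m ≤ |(q : ℝ)|)
    (A B : ℝ) (hA : 0 < A) (hB : 0 < B)
    (hIa : ∫ x, ‖expS (s.biUnion Qf) x‖ ^ (2 * k) ∂mu1 ≤ A ^ (2 * k))
    (hIj : ∫ x, ‖expS (Qf j) x‖ ^ (2 * k) ∂mu1 ≤ B ^ (2 * k))
    (hIb : ∀ i ∈ s, ∫ x, ‖expS (Qf i) x‖ ^ (2 * k) ∂mu1 ≤ B ^ (2 * k)) :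
    ∫ x, ‖expS (s.biUnion Qf) x‖ ^ (2 * k - 2) *
        ((starRingEnd ℂ) (expS (s.biUnion Qf) x) * expS (Qf j) x).re ∂mu1
      ≤ 4 * k * A ^ (2 * k - 2) * B ^ 2 := by
  classical
  set P := s.biUnion Qf with hP
  set W : ℤ → ℝ := fun q => ∑ i ∈ s, if q ∈ Qf i then (4 : ℝ) ^ i * m else 0 with hWdef
  have hm' : (0 : ℝ) < m := by exact_mod_cast hm
  have hW : ∀ q ∈ P, |(q : ℝ)| ≤ W q := by
    intro q hq
    obtain ⟨i, hi, hqi⟩ := Finset.mem_biUnion.mp hq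
    refine (hup i hi q hqi).trans ?_
    have := Finset.single_le_sum (f := fun i => if q ∈ Qf i then (4 : ℝ) ^ i * m else 0)
      (fun i _ => by split_ifs <;> positivity) hi
    simpa [hqi] using this
  have hD : ∀ x : AddCircle (1 : ℝ), ‖∑ q ∈ P, (W q : ℂ) * fourier q x‖ ≤
      ∑ i ∈ s, 4 ^ i * m * ‖expS (Qf i) x‖ := by
    intro x
    have : ∑ q ∈ P, (W q : ℂ) * fourier q x = ∑ i ∈ s, (((4 : ℝ) ^ i * m : ℝ) : ℂ) * expS (Qf i) x := by
      simp only [hWdef, Complex.ofReal_sum, Finset.sum_mul]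
      rw [Finset.sum_comm]
      refine Finset.sum_congr rfl fun i hi => ?_
      unfold expS
      rw [Finset.mul_sum]
      have hsub : Qf i ⊆ P := Finset.subset_biUnion_of_mem Qf hi
      rw [← Finset.sum_subset hsub (f := fun q => (((if q ∈ Qf i then (4 : ℝ) ^ i * m else 0 : ℝ)) : ℂ) * fourier q x)]
      · exact Finset.sum_congr rfl fun q hq => by simp [hq]
      · intro q _ hq; simp [hq]
    rw [this]
    refine (norm_sum_le _ _).trans (Finset.sum_le_sum fun i _ => ?_)
    rw [norm_mul, Complex.norm_real, Real.norm_of_nonneg (by positivity)]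
  have hcP := expS_cont P
  have hcj := expS_cont (Qf j)
  -- products of three
  have h3 : ∀ i ∈ s, ∫ x, ‖expS (Qf j) x‖ * ‖expS (Qf i) x‖ * ‖expS P x‖ ^ (2 * k - 2) ∂mu1
      ≤ A ^ (2 * k - 2) * B ^ 2 := by
    intro i hi
    have hci := expS_cont (Qf i)
    have b1 := hold (2 * k) 2 (by omega) (by omega) _ _ hcP.norm hcj.norm (fun _ => norm_nonneg _)
      (fun _ => norm_nonneg _) A B hA hB hIa hIj
    have b2 := hold (2 * k) 2 (by omega) (by omega) _ _ hcP.norm hci.norm (fun _ => norm_nonneg _)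
      (fun _ => norm_nonneg _) A B hA hB hIa (hIb i hi)
    have i1 : Integrable (fun x => ‖expS P x‖ ^ (2 * k - 2) * ‖expS (Qf j) x‖ ^ 2) mu1 := by
      apply integ; fun_prop
    have i2 : Integrable (fun x => ‖expS P x‖ ^ (2 * k - 2) * ‖expS (Qf i) x‖ ^ 2) mu1 := by
      apply integ; fun_prop
    calc _ ≤ ∫ x, (1 / 2 * (‖expS P x‖ ^ (2 * k - 2) * ‖expS (Qf j) x‖ ^ 2) +
          1 / 2 * (‖expS P x‖ ^ (2 * k - 2) * ‖expS (Qf i) x‖ ^ 2)) ∂mu1 := by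
          refine integral_mono (by apply integ; fun_prop) ((i1.const_mul _).add (i2.const_mul _))
            fun x => ?_
          have hp : 0 ≤ ‖expS P x‖ ^ (2 * k - 2) := by positivity
          have := mul_nonneg hp (sq_nonneg (‖expS (Qf j) x‖ - ‖expS (Qf i) x‖))
          simp only
          nlinarith
      _ ≤ _ := by
          rw [integral_add (i1.const_mul _) (i2.const_mul _), integral_const_mul, integral_const_mul]
          linarith
  have hint : ∫ x, ‖expS (Qf j) x‖ * ‖∑ q ∈ P, (W q : ℂ) * fourier q x‖ *
        ‖expS P x‖ ^ (2 * k - 2) ∂mu1 ≤ 4 ^ j * m * (A ^ (2 * k - 2) * B ^ 2) := by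
    have hcD : Continuous fun x : AddCircle (1 : ℝ) => ∑ q ∈ P, (W q : ℂ) * fourier q x :=
      continuous_finsetSum _ fun q _ => continuous_const.mul (fourier q).continuous
    have hii : ∀ i ∈ s, Integrable (fun x => 4 ^ i * m *
        (‖expS (Qf j) x‖ * ‖expS (Qf i) x‖ * ‖expS P x‖ ^ (2 * k - 2))) mu1 := by
      intro i _
      have hci := expS_cont (Qf i)
      apply integ; fun_prop
    calc _ ≤ ∫ x, ∑ i ∈ s, 4 ^ i * m *
        (‖expS (Qf j) x‖ * ‖expS (Qf i) x‖ * ‖expS P x‖ ^ (2 * k - 2)) ∂mu1 := by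
          refine integral_mono (integ ((hcj.norm.mul hcD.norm).mul (hcP.norm.pow _)))
            (integrable_finsetSum _ hii) fun x => ?_
          calc _ ≤ ‖expS (Qf j) x‖ * (∑ i ∈ s, 4 ^ i * m * ‖expS (Qf i) x‖) *
                ‖expS P x‖ ^ (2 * k - 2) := by
                gcongr
                exact hD x
            _ = _ := by
                rw [Finset.mul_sum, Finset.sum_mul]
                exact Finset.sum_congr rfl fun i _ => by ring
      _ ≤ ∑ i ∈ s, 4 ^ i * m * (A ^ (2 * k - 2) * B ^ 2) := by
          rw [integral_finsetSum _ hii]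
          refine Finset.sum_le_sum fun i hi => ?_
          rw [integral_const_mul]
          gcongr
          exact h3 i hi
      _ ≤ _ := by
          rw [← Finset.sum_mul, ← Finset.sum_mul]
          gcongr
          exact sum_four s j hsj
  have hcount := lin_count (ι := Fin k ⊕ Fin k) (Sum.inl ⟨0, hk⟩)
    (Sum.elim (fun _ => 1) (fun _ => -1)) (by rintro (a | a) <;> simp) P (Qf j) W
    ((4 : ℝ) ^ j / 2 * m) hlow hW
  rw [← lin_eq k hk P (Qf j), Finset.sum_const, Finset.card_erase_of_mem (Finset.mem_univ _),
    Finset.card_univ, Fintype.card_sum, Fintype.card_fin, nsmul_eq_mul, ← two_mul] at hcount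
  have hkk : ((2 * k - 1 : ℕ) : ℝ) ≤ 2 * k := by
    have : 2 * k - 1 ≤ 2 * k := by omega
    exact_mod_cast this
  have hV : 0 < (4 : ℝ) ^ j / 2 * m := by positivity
  have hfin : (4 : ℝ) ^ j / 2 * m * ∫ x, ‖expS P x‖ ^ (2 * k - 2) *
        ((starRingEnd ℂ) (expS P x) * expS (Qf j) x).re ∂mu1 ≤
      (4 : ℝ) ^ j / 2 * m * (4 * k * A ^ (2 * k - 2) * B ^ 2) := by
    refine hcount.trans ?_
    calc _ ≤ 2 * (k : ℝ) * (4 ^ j * m * (A ^ (2 * k - 2) * B ^ 2)) := by gcongr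
      _ = _ := by ring
  exact le_of_mul_le_mul_left hfin hV

theorem induct_bound (k m N : ℕ) (hk : 0 < k) (hm : 0 < m) (hN : 0 < N)
    (Qf : ℤ → Finset ℤ) (B : ℝ) (hB : 0 < B) (hBN : B ^ (2 * k) = (N : ℝ) ^ (2 * k - 1))
    (J : Finset ℤ)
    (hup : ∀ i ∈ J, ∀ q ∈ Qf i, |(q : ℝ)| ≤ 4 ^ i * m)
    (hlow : ∀ i ∈ J, ∀ q ∈ Qf i, (4 : ℝ) ^ i / 2 * m ≤ |(q : ℝ)|)
    (hQcard : ∀ i ∈ J, (Qf i).card = N)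
    (hdisj : ∀ i ∈ J, ∀ j ∈ J, i ≠ j → Disjoint (Qf i) (Qf j)) :
    ∫ x, ‖expS (J.biUnion Qf) x‖ ^ (2 * k) ∂mu1 ≤ (22 * k * B ^ 2 * J.card) ^ k := by
  have hk' : (1 : ℝ) ≤ k := by exact_mod_cast hk
  induction J using Finset.induction_on_max with
  | empty => simp [expS, hk.ne']
  | insert j s hs ih =>
    have hjs : j ∉ s := fun h => lt_irrefl _ (hs j h)
    have mem : ∀ i ∈ s, i ∈ insert j s := fun i hi => Finset.mem_insert_of_mem hi
    have hj := Finset.mem_insert_self j s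
    have ih' := ih (fun i hi => hup i (mem i hi)) (fun i hi => hlow i (mem i hi))
      (fun i hi => hQcard i (mem i hi)) (fun i hi i' hi' => hdisj i (mem i hi) i' (mem i' hi'))
    have hIb : ∀ i ∈ insert j s, ∫ x, ‖expS (Qf i) x‖ ^ (2 * k) ∂mu1 ≤ B ^ (2 * k) := by
      intro i hi; rw [hBN]; exact level_bound k N hk _ (hQcard i hi)
    rw [Finset.biUnion_insert, Finset.card_insert_of_notMem hjs]
    rcases s.eq_empty_or_nonempty with rfl | hne
    · simp only [Finset.biUnion_empty, Finset.union_empty, Finset.card_empty]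
      refine (hIb j hj).trans ?_
      rw [pow_mul]
      gcongr
      push_cast
      nlinarith [sq_nonneg B]
    · have hc : (1 : ℝ) ≤ s.card := by exact_mod_cast hne.card_pos
      set A : ℝ := Real.sqrt (22 * k * B ^ 2 * s.card) with hAdef
      have hA : 0 < A := Real.sqrt_pos.mpr (by positivity)
      have hA2 : A ^ 2 = 22 * k * B ^ 2 * s.card := Real.sq_sqrt (by positivity)
      have hIa : ∫ x, ‖expS (s.biUnion Qf) x‖ ^ (2 * k) ∂mu1 ≤ A ^ (2 * k) := by
        rw [pow_mul A, hA2]; exact ih'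
      have hd : Disjoint (s.biUnion Qf) (Qf j) := by
        rw [Finset.disjoint_biUnion_left]
        intro i hi
        exact hdisj i (mem i hi) j hj (fun h => hjs (h ▸ hi))
      have h1 := step_int k hk _ _ hd A B hA hB hIa (hIb j hj)
      have h2 := lin_bound k m hk hm s j hs Qf (fun i hi => hup i (mem i hi)) (hlow j hj) A B hA hB
        hIa (hIb j hj) (fun i hi => hIb i (mem i hi))
      have h3 := numeric2 k hk A B hA hB.le
      have h4 := mul_le_mul_of_nonneg_left h2 (show (0 : ℝ) ≤ 2 * k by positivity)
      rw [Finset.union_comm]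
      have e : 22 * (k : ℝ) * B ^ 2 * ((s.card + 1 : ℕ) : ℝ) = A ^ 2 + 22 * k * B ^ 2 := by
        rw [hA2]; push_cast; ring
      rw [e]
      refine le_trans ?_ h3
      refine h1.trans ?_
      have e2 : 2 * (k : ℝ) * (4 * k * A ^ (2 * k - 2) * B ^ 2)
        = 8 * k ^ 2 * A ^ (2 * k - 2) * B ^ 2 := by ring
      linarith

/-- Let `I, k, m, N` be positive integers, `J ⊆ ℤ` with `|J| = I`, and
for `i ∈ J` let `Q_i ⊆ ([-4^i m, -(4^i/2) m) ∪ ((4^i/2) m, 4^i m]) ∩ ℤ` with `|Q_i| = N`,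
pairwise disjoint. Then `Q = ⋃_{i∈J} Q_i` satisfies `T_k(Q) ≤ 2^{8k} k^k I^k N^{2k-1}`. -/
theorem stmt11 (I k m N : ℕ) (hI : 0 < I) (hk : 0 < k) (hm : 0 < m) (hN : 0 < N)
    (J : Finset ℤ) (hJ : J.card = I) (Qf : ℤ → Finset ℤ)
    (hQmem : ∀ i ∈ J, ∀ q ∈ Qf i,
      (q : ℝ) ∈ Set.Ico (-((4:ℝ) ^ i * m)) (-((4:ℝ) ^ i / 2 * m)) ∪
        Set.Ioc ((4:ℝ) ^ i / 2 * m) ((4:ℝ) ^ i * m))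
    (hQcard : ∀ i ∈ J, (Qf i).card = N)
    (hdisj : ∀ i ∈ J, ∀ j ∈ J, i ≠ j → Disjoint (Qf i) (Qf j)) :
    (TkZ k (J.biUnion Qf) : ℝ) ≤ 2 ^ (8 * k) * k ^ k * I ^ k * N ^ (2 * k - 1) := by
  have hNr : (0 : ℝ) < N := by exact_mod_cast hN
  set B : ℝ := ((N : ℝ) ^ (2 * k - 1)) ^ (((2 * k : ℕ) : ℝ)⁻¹) with hBdef
  have hB : 0 < B := by positivity
  have hBN : B ^ (2 * k) = (N : ℝ) ^ (2 * k - 1) :=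
    Real.rpow_inv_natCast_pow (by positivity) (by omega)
  have hm' : (0 : ℝ) < m := by exact_mod_cast hm
  have hup : ∀ i ∈ J, ∀ q ∈ Qf i, |(q : ℝ)| ≤ 4 ^ i * m := by
    intro i hi q hq
    have hp : (0 : ℝ) < 4 ^ i * m := by positivity
    rcases hQmem i hi q hq with h | h
    · rw [abs_le]; exact ⟨h.1, by linarith [h.2]⟩
    · rw [abs_le]; exact ⟨by linarith [h.1], h.2⟩
  have hlow : ∀ i ∈ J, ∀ q ∈ Qf i, (4 : ℝ) ^ i / 2 * m ≤ |(q : ℝ)| := by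
    intro i hi q hq
    rcases hQmem i hi q hq with h | h
    · rw [le_abs]; right; linarith [h.2]
    · rw [le_abs]; left; exact h.1.le
  have h := induct_bound k m N hk hm hN Qf B hB hBN J hup hlow hQcard hdisj
  rw [Tk_eq]
  refine h.trans ?_
  rw [hJ, mul_pow, mul_pow, mul_pow, ← pow_mul, hBN]
  have h22 : (22 : ℝ) ^ k ≤ 2 ^ (8 * k) := by
    rw [pow_mul]; gcongr; norm_num
  calc (22 : ℝ) ^ k * k ^ k * N ^ (2 * k - 1) * I ^ k = 22 ^ k * k ^ k * I ^ k * N ^ (2 * k - 1) := by ring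
    _ ≤ _ := by gcongr
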